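/- Let (X, d, μ) be a rectifiable metric median algebra. Then d_μ is a metric on X; (X, d_μ) is a median metric space whose intrinsic median operation equals μ; d_μ(g(x), g(y)) = d_μ(x,y) for every isometry g of (X,d) satisfying g(μ(x₁,x₂,x₃)) = μ(g(x₁),g(x₂),g(x₃)) for all x₁,x₂,x₃; and if (X,d,μ) is uniformly rectifiable with constant L, then d(x,y) ≤ d_μ(x,y) ≤ L·d(x,y) for all x,y ∈ X. -/

import Mathlib

/-- The axioms of a median algebra for a ternary operation. -/
def IsMedianFn {X : Type*} (μ : X → X → X → X) : Prop :=
  (∀ x y z, μ x y z = μ x z y) ∧ (∀ x y z, μ x y z = μ y z x) ∧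
    (∀ x y, μ x x y = x) ∧
    ∀ x y z u v, μ (μ x y z) u v = μ x (μ y u v) (μ z u v)

/-- A subset closed under the median operation. -/
def IsSubalgebra {X : Type*} (μ : X → X → X → X) (M : Set X) : Prop :=
  ∀ a ∈ M, ∀ b ∈ M, ∀ c ∈ M, μ a b c ∈ M

/-- `h` is convex in the subalgebra `M`: it contains `I(a,b) ∩ M` for all `a, b ∈ h`. -/
def ConvexIn {X : Type*} (μ : X → X → X → X) (M h : Set X) : Prop :=
  ∀ a ∈ h, ∀ b ∈ h, ∀ z ∈ M, μ a b z = z → z ∈ h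

/-- A halfspace of the subalgebra `M`: one side of a wall of `M`, i.e. a nonempty convex
subset of `M` with nonempty convex complement `M \ h`.  Walls of `M` correspond to
(unordered) pairs `{h, M \ h}` of complementary halfspaces. -/
def IsHalfspaceIn {X : Type*} (μ : X → X → X → X) (M h : Set X) : Prop :=
  h ⊆ M ∧ h.Nonempty ∧ (M \ h).Nonempty ∧ ConvexIn μ M h ∧ ConvexIn μ M (M \ h)

/-- `a` and `b` are adjacent (form an edge) in `M` if exactly one wall of `M` separates
them; separating walls are represented by the halfspace containing `a` and not `b`. -/
def AdjacentIn {X : Type*} (μ : X → X → X → X) (M : Set X) (a b : X) : Prop :=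
  a ∈ M ∧ b ∈ M ∧ ∃! h : Set X, IsHalfspaceIn μ M h ∧ a ∈ h ∧ b ∉ h

/-- `λ_max^M(W)` for the wall `W = {h, M \ h}`: the maximal length `d(a,b)` of an edge
`{a,b}` of `M` crossing the wall. -/
noncomputable def lamMax {X : Type*} [MetricSpace X] (μ : X → X → X → X) (M h : Set X) : ℝ :=
  sSup {r : ℝ | ∃ a b, AdjacentIn μ M a b ∧ a ∈ h ∧ b ∈ M \ h ∧ r = dist a b}

/-- `d_μ^M(x,y) = Σ_{W ∈ 𝒲^M(x|y)} λ_max^M(W)` if `x, y ∈ M` and `0` otherwise; the walls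
separating `x` from `y` are represented by their halfspaces containing `x` and not `y`. -/
noncomputable def dmuM {X : Type*} [MetricSpace X] (μ : X → X → X → X) (M : Set X)
    (x y : X) : ℝ :=
  ∑ᶠ h ∈ {h : Set X | IsHalfspaceIn μ M h ∧ x ∈ h ∧ y ∈ M \ h}, lamMax μ M h

/-- `d_μ(x,y)`: the supremum of `d_μ^M(x,y)` over all finite subalgebras `M` of `(X, μ)`. -/
noncomputable def dmu {X : Type*} [MetricSpace X] (μ : X → X → X → X) (x y : X) : ℝ :=
  sSup {r : ℝ | ∃ M : Set X, M.Finite ∧ IsSubalgebra μ M ∧ r = dmuM μ M x y}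

namespace IsMedianFn

variable {X : Type*} {μ : X → X → X → X}

theorem swap_right (hμ : IsMedianFn μ) (x y z : X) : μ x y z = μ x z y := hμ.1 x y z

theorem rotate (hμ : IsMedianFn μ) (x y z : X) : μ x y z = μ y z x := hμ.2.1 x y z

theorem swap_left (hμ : IsMedianFn μ) (x y z : X) : μ x y z = μ y x z :=
  (hμ.rotate x y z).trans (hμ.swap_right y z x)

theorem left_self (hμ : IsMedianFn μ) (x y : X) : μ x x y = x := hμ.2.2.1 x y

theorem outer_self (hμ : IsMedianFn μ) (x y : X) : μ x y x = x :=
  (hμ.swap_right x y x).trans (hμ.left_self x y)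

theorem right_self (hμ : IsMedianFn μ) (x y : X) : μ x y y = y :=
  (hμ.rotate x y y).trans (hμ.left_self y x)

theorem distrib (hμ : IsMedianFn μ) (x y z u v : X) :
    μ (μ x y z) u v = μ x (μ y u v) (μ z u v) := hμ.2.2.2 x y z u v

/-- The projection `μ a b` distributes over the last two arguments of a median. -/
theorem proj_median (hμ : IsMedianFn μ) (a b x y z : X) :
    μ a b (μ x y z) = μ x (μ a b y) (μ a b z) := by
  rw [← hμ.rotate, hμ.distrib, hμ.rotate y, hμ.rotate z]

/-- The projection to an interval takes values in that interval. -/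
theorem proj_proj (hμ : IsMedianFn μ) (a b x : X) : μ a b (μ a b x) = μ a b x := by
  rw [← hμ.rotate x, hμ.proj_median, hμ.outer_self, hμ.right_self]

/-- The projection to an interval is a median homomorphism. -/
theorem proj_hom (hμ : IsMedianFn μ) (a b x y z : X) :
    μ a b (μ x y z) = μ (μ a b x) (μ a b y) (μ a b z) := by
  rw [← hμ.proj_proj a b (μ x y z), hμ.proj_median a b x, hμ.rotate x, hμ.rotate (μ a b y),
    hμ.proj_median, hμ.proj_proj, hμ.rotate, hμ.rotate]

theorem interval_median (hμ : IsMedianFn μ) {a b x y : X} (c : X) (hx : μ a b x = x)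
    (hy : μ a b y = y) : μ a b (μ c x y) = μ c x y := by
  rw [hμ.proj_median, hx, hy]

/-- Associativity of the meet operation `μ a`. -/
theorem assoc (hμ : IsMedianFn μ) (a x y z : X) : μ a (μ a x y) z = μ a x (μ a y z) := by
  rw [hμ.swap_left a (μ a x y) z, hμ.swap_left a x y, hμ.distrib, hμ.left_self,
    hμ.swap_left x a, hμ.swap_left y a z]

theorem absorb (hμ : IsMedianFn μ) {a b x : X} (y : X) (hx : μ a b x = x) :
    μ a x (μ b x y) = x := by
  rw [← hμ.rotate y b x, hμ.proj_median, hμ.right_self, hμ.swap_right a x b, hx, hμ.right_self]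

/-- The interval between `a` and `b` is a distributive lattice with meet `μ a` and join `μ b`. -/
abbrev intervalLattice (hμ : IsMedianFn μ) (a b : X) : DistribLattice {z // μ a b z = z} :=
  letI : Max {z // μ a b z = z} := ⟨fun x y => ⟨μ b x y, hμ.interval_median b x.2 y.2⟩⟩
  letI : Min {z // μ a b z = z} := ⟨fun x y => ⟨μ a x y, hμ.interval_median a x.2 y.2⟩⟩
  letI : Lattice {z // μ a b z = z} := Lattice.mk'
    (fun x y => Subtype.ext (hμ.swap_right b x y))
    (fun x y z => Subtype.ext (hμ.assoc b x y z))
    (fun x y => Subtype.ext (hμ.swap_right a x y))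
    (fun x y z => Subtype.ext (hμ.assoc a x y z))
    (fun x y => Subtype.ext (hμ.absorb (b := a) y.1 ((hμ.swap_left b a x).trans x.2)))
    (fun x y => Subtype.ext (hμ.absorb (b := b) y.1 x.2))
  DistribLattice.ofInfSupLe fun x y z => le_of_eq (Subtype.ext (hμ.proj_median a x b y z))

/-- In an interval, the median is given by the lattice formula. -/
theorem median_eq_sup_inf (hμ : IsMedianFn μ) {a b x y z : X} (hx : μ a b x = x)
    (hy : μ a b y = y) (hz : μ a b z = z) :
    μ x y z = μ b (μ a x z) (μ a y (μ b x z)) := by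
  have hp : μ a b (μ a x z) = μ a x z := hμ.interval_median a hx hz
  have hpq : μ b (μ a x z) (μ b x z) = μ b x z := by
    rw [← hμ.assoc, hμ.swap_right b _ x, hμ.absorb z ((hμ.swap_left b a x).trans hx)]
  rw [hμ.rotate a y, hμ.proj_median, hpq, ← hμ.rotate a b, hp, hμ.swap_right y,
    hμ.rotate a x, hμ.rotate b x, ← hμ.proj_median, hμ.rotate y, hy, hμ.swap_right]

/-- A finite set is contained in a finite subalgebra. -/
theorem exists_finite_subalgebra (hμ : IsMedianFn μ) {S : Set X} (hS : S.Finite) :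
    ∃ N : Set X, N.Finite ∧ IsSubalgebra μ N ∧ S ⊆ N := by
  let N : Set X := ⋂₀ {K | IsSubalgebra μ K ∧ S ⊆ K}
  have hNS : S ⊆ N := Set.subset_sInter fun K hK => hK.2
  have hmin : ∀ K, IsSubalgebra μ K → S ⊆ K → N ⊆ K := fun K h1 h2 =>
    Set.sInter_subset_of_mem ⟨h1, h2⟩
  have hsub : IsSubalgebra μ N := fun a ha b hb c hc K hK =>
    hK.1 a (ha K hK) b (hb K hK) c (hc K hK)
  have hproj : ∀ a b, ((μ a b) '' N).Finite := by
    intro a b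
    let := hμ.intervalLattice a b
    let T : Set {z // μ a b z = z} := (fun s => ⟨μ a b s, hμ.proj_proj a b s⟩) '' S
    have hT : (latticeClosure T).Finite := (hS.image _).latticeClosure
    have hK : N ⊆ {z | μ a b z ∈ Subtype.val '' latticeClosure T} := by
      apply hmin
      · rintro x ⟨p, hp, hpx⟩ y ⟨q, hq, hqy⟩ z ⟨r, hr, hrz⟩
        have hL := isSublattice_latticeClosure (s := T)
        refine ⟨(p ⊓ r) ⊔ (q ⊓ (p ⊔ r)),
          hL.supClosed (hL.infClosed hp hr) (hL.infClosed hq (hL.supClosed hp hr)), ?_⟩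
        rw [hμ.proj_hom, ← hpx, ← hqy, ← hrz, hμ.median_eq_sup_inf p.2 q.2 r.2]
        rfl
      · exact fun s hs => ⟨_, subset_latticeClosure ⟨s, hs, rfl⟩, rfl⟩
    exact (hT.image _).subset (Set.image_subset_iff.2 hK)
  have hsep : ∀ z ∈ N, ∀ w ∈ N, (∀ a ∈ S, ∀ b ∈ S, μ a b z = μ a b w) → z = w := by
    intro z hz w hw H
    have hsubalg : ∀ a, IsSubalgebra μ {b | μ a b z = μ a b w} := by
      intro a x hx y hy t ht
      change μ a (μ x y t) z = μ a (μ x y t) w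
      rw [hμ.swap_right a _ z, hμ.swap_right a _ w, hμ.proj_hom a z x y t,
        hμ.proj_hom a w x y t, hμ.swap_right a z x, hμ.swap_right a z y, hμ.swap_right a z t,
        hμ.swap_right a w x, hμ.swap_right a w y, hμ.swap_right a w t]
      exact congr (congrArg₂ μ hx hy) ht
    have h1 : ∀ a ∈ S, ∀ b ∈ N, μ a b z = μ a b w := fun a ha =>
      hmin _ (hsubalg a) (H a ha)
    have h2 : ∀ a ∈ N, μ z a z = μ z a w := by
      refine hmin _ (hsubalg z) fun a ha => ?_
      have := h1 a ha z hz
      rwa [hμ.swap_left a z z, hμ.swap_left a z w] at this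
    simpa [hμ.outer_self, hμ.right_self] using h2 w hw
  have : Finite S := hS
  refine ⟨N, ?_, hsub, hNS⟩
  refine Set.Finite.of_injOn (f := fun z (p : S × S) => μ p.1 p.2 z)
    (t := Set.pi Set.univ fun p : S × S => (μ p.1 p.2) '' N) ?_ ?_
    (Set.Finite.pi fun p => hproj p.1 p.2)
  · exact fun z hz p _ => ⟨z, hz, rfl⟩
  · exact fun z hz w hw h => hsep z hz w hw fun a ha b hb => congrFun h (⟨a, ha⟩, ⟨b, hb⟩)

/-- The median is the only point lying in all three intervals. -/
theorem eq_median_of_mem_intervals (hμ : IsMedianFn μ) {x y z w : X} (h1 : μ x y w = w)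
    (h2 : μ y z w = w) (h3 : μ z x w = w) : w = μ x y z := by
  have hy : μ w (μ x y z) y = w := by
    rw [hμ.swap_right, hμ.proj_median, hμ.right_self, hμ.rotate w, h2, h1]
  have hz : μ w (μ x y z) z = w := by
    rw [hμ.swap_right, hμ.proj_median, hμ.right_self, hμ.rotate w, hμ.swap_left z, h2,
      hμ.swap_right, hμ.swap_left, h3]
  calc w = μ x (μ w (μ x y z) y) (μ w (μ x y z) z) := by rw [hy, hz, hμ.right_self]
    _ = μ w (μ x y z) (μ x y z) := (hμ.proj_median _ _ _ _ _).symm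
    _ = μ x y z := hμ.right_self _ _

end IsMedianFn

section Halfspaces

variable {X : Type*} {μ : X → X → X → X} {M N h : Set X} {x y a b w : X}

/-- The halfspaces of `M` containing `x` and not `y`. -/
def separators (μ : X → X → X → X) (M : Set X) (x y : X) : Set (Set X) :=
  {h : Set X | IsHalfspaceIn μ M h ∧ x ∈ h ∧ y ∈ M \ h}

theorem IsHalfspaceIn.compl (hh : IsHalfspaceIn μ M h) : IsHalfspaceIn μ M (M \ h) := by
  obtain ⟨h1, h2, h3, h4, h5⟩ := hh
  have : M \ (M \ h) = h := Set.sdiff_sdiff_cancel_left h1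
  exact ⟨Set.sdiff_subset, h3, this.symm ▸ h2, h5, this.symm ▸ h4⟩

theorem separators_finite (hM : M.Finite) : (separators μ M x y).Finite :=
  hM.finite_subsets.subset fun _ hh => hh.1.1

theorem compl_mem_separators (hh : h ∈ separators μ M x y) :
    M \ h ∈ separators μ M y x :=
  ⟨hh.1.compl, hh.2.2, hh.1.1 hh.2.1, fun hx => hx.2 hh.2.1⟩

theorem separators_self : separators μ M x x = ∅ :=
  Set.eq_empty_of_forall_notMem fun _ hh => hh.2.2.2 hh.2.1

theorem separators_subset_union (hy : y ∈ M) :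
    separators μ M x w ⊆ separators μ M x y ∪ separators μ M y w := by
  intro h hh
  by_cases hyh : y ∈ h
  · exact Or.inr ⟨hh.1, hyh, hh.2.2⟩
  · exact Or.inl ⟨hh.1, hh.2.1, hy, hyh⟩

theorem separators_disjoint : Disjoint (separators μ M x w) (separators μ M w y) :=
  Set.disjoint_left.2 fun _ h1 h2 => h1.2.2.2 h2.2.1

theorem separators_eq_union (hx : x ∈ M) (hy : y ∈ M) (hw : w ∈ M)
    (hi : μ x y w = w) :
    separators μ M x y = separators μ M x w ∪ separators μ M w y := by
  refine (separators_subset_union hw).antisymm ?_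
  rintro h (⟨hh, h1, h2⟩ | ⟨hh, h1, h2⟩)
  · exact ⟨hh, h1, hy, fun h3 => h2.2 (hh.2.2.2.1 x h1 y h3 w hw hi)⟩
  · exact ⟨hh, by_contra fun h3 => (hh.2.2.2.2 x ⟨hx, h3⟩ y h2 w hw hi).2 h1, h2⟩

/-- A halfspace of a larger subalgebra separating two points of `M` restricts to `M`. -/
theorem inter_mem_separators (hMN : M ⊆ N) (hx : x ∈ M) (hy : y ∈ M)
    (hh : h ∈ separators μ N x y) : h ∩ M ∈ separators μ M x y := by
  obtain ⟨⟨h1, h2, h3, h4, h5⟩, h6, h7⟩ := hh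
  refine ⟨⟨Set.inter_subset_right, ⟨x, h6, hx⟩, ⟨y, hy, fun h => h7.2 h.1⟩, ?_, ?_⟩,
    ⟨h6, hx⟩, hy, fun h => h7.2 h.1⟩
  · exact fun a ha b hb z hz hi => ⟨h4 a ha.1 b hb.1 z (hMN hz) hi, hz⟩
  · refine fun a ha b hb z hz hi => ⟨hz, fun hzh => ?_⟩
    exact (h5 a ⟨hMN ha.1, fun h => ha.2 ⟨h, ha.1⟩⟩ b ⟨hMN hb.1, fun h => hb.2 ⟨h, hb.1⟩⟩ z
      (hMN hz) hi).2 hzh.1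

theorem AdjacentIn.symm (hab : AdjacentIn μ M a b) : AdjacentIn μ M b a := by
  obtain ⟨ha, hb, h, ⟨hh, hah, hbh⟩, huniq⟩ := hab
  refine ⟨hb, ha, M \ h, ⟨hh.compl, ⟨hb, hbh⟩, fun h' => h'.2 hah⟩, ?_⟩
  rintro k ⟨hk, hbk, hak⟩
  have := huniq (M \ k) ⟨hk.compl, ⟨ha, hak⟩, fun h' => h'.2 hbk⟩
  rw [← this, Set.sdiff_sdiff_cancel_left hk.1]

/-- Two distinct points with nothing between them are adjacent. -/
theorem adjacentIn_of_interval (hμ : IsMedianFn μ) (hM : IsSubalgebra μ M) (ha : a ∈ M)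
    (hb : b ∈ M) (hne : a ≠ b) (hi : ∀ z ∈ M, μ a b z = z → z = a ∨ z = b) :
    AdjacentIn μ M a b := by
  have hval : ∀ z ∈ M, μ a b z = a ∨ μ a b z = b := fun z hz =>
    hi _ (hM a ha b hb z hz) (hμ.proj_proj a b z)
  have hcompl : M \ {z ∈ M | μ a b z = a} = {z ∈ M | μ a b z = b} := by
    ext z
    simp only [Set.mem_sdiff, Set.mem_ofPred_eq, not_and]
    refine ⟨fun h => ⟨h.1, (hval z h.1).resolve_left (h.2 h.1)⟩, fun h => ⟨h.1, fun _ h' => ?_⟩⟩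
    exact hne (h'.symm.trans h.2)
  have hconv : ∀ c, ConvexIn μ M {z ∈ M | μ a b z = c} := by
    rintro c x hx y hy z hz hxy
    refine ⟨hz, ?_⟩
    rw [← hxy, hμ.proj_hom, hx.2, hy.2, hμ.left_self]
  have haa : μ a b a = a := hμ.outer_self a b
  have hbb : μ a b b = b := hμ.right_self a b
  refine ⟨ha, hb, {z ∈ M | μ a b z = a}, ⟨⟨Set.sep_subset _ _, ⟨a, ha, haa⟩, ?_, hconv a, ?_⟩,
    ⟨ha, haa⟩, fun h => hne (h.2.symm.trans hbb)⟩, ?_⟩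
  · rw [hcompl]
    exact ⟨b, hb, hbb⟩
  · rw [hcompl]
    exact hconv b
  · rintro k ⟨hk, hak, hbk⟩
    ext z
    constructor
    · intro hz
      refine ⟨hk.1 hz, (hval z (hk.1 hz)).resolve_right fun h => hbk ?_⟩
      refine hk.2.2.2.1 a hak z hz b hb ?_
      rw [hμ.swap_right, h]
    · rintro ⟨hz, h⟩
      by_contra hzk
      refine (hk.2.2.2.2 b ⟨hb, hbk⟩ z ⟨hz, hzk⟩ a ha ?_).2 hak
      rw [← hμ.rotate, h]

end Halfspaces

section Distance

variable {X : Type*} [MetricSpace X] {μ : X → X → X → X} {M N h : Set X} {x y a b w : X}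

theorem lamMax_nonneg : 0 ≤ lamMax μ M h := by
  refine Real.sSup_nonneg ?_
  rintro r ⟨a, b, -, -, -, rfl⟩
  exact dist_nonneg

theorem dist_le_lamMax (hM : M.Finite) (hab : AdjacentIn μ M a b) (ha : a ∈ h) (hb : b ∉ h) :
    dist a b ≤ lamMax μ M h := by
  refine le_csSup (((hM.prod hM).image fun p => dist p.1 p.2).subset ?_).bddAbove
    ⟨a, b, hab, ha, ⟨hab.2.1, hb⟩, rfl⟩
  rintro r ⟨c, d, hcd, -, -, rfl⟩
  exact ⟨(c, d), ⟨hcd.1, hcd.2.1⟩, rfl⟩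

theorem lamMax_compl (hh : h ⊆ M) : lamMax μ M (M \ h) = lamMax μ M h := by
  unfold lamMax
  congr 1
  ext r
  simp only [Set.mem_ofPred_eq, Set.sdiff_sdiff_cancel_left hh]
  constructor <;> rintro ⟨a, b, hab, ha, hb, rfl⟩ <;>
    exact ⟨b, a, hab.symm, hb, ha, dist_comm _ _⟩

theorem dmuM_eq_sum (hM : M.Finite) :
    dmuM μ M x y = ∑ h ∈ (separators_finite (μ := μ) (x := x) (y := y) hM).toFinset,
      lamMax μ M h :=
  finsum_mem_eq_finite_toFinset_sum _ _

theorem dmuM_nonneg : 0 ≤ dmuM μ M x y :=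
  finsum_nonneg fun _ => finsum_nonneg fun _ => lamMax_nonneg

theorem dmuM_self : dmuM μ M x x = 0 := by
  change ∑ᶠ h ∈ separators μ M x x, lamMax μ M h = 0
  rw [separators_self, finsum_mem_empty]

theorem dmuM_comm : dmuM μ M x y = dmuM μ M y x := by
  refine finsum_mem_eq_of_bijOn (fun h => M \ h)
    (Set.BijOn.mk (fun h hh => compl_mem_separators hh) ?_ ?_)
    fun h hh => (lamMax_compl hh.1.1).symm
  · intro h hh k hk hhk
    rw [← Set.sdiff_sdiff_cancel_left hh.1.1, ← Set.sdiff_sdiff_cancel_left hk.1.1]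
    exact congrArg (M \ ·) hhk
  · exact fun h hh => ⟨M \ h, compl_mem_separators hh, Set.sdiff_sdiff_cancel_left hh.1.1⟩

theorem dmuM_triangle (hM : M.Finite) (hw : w ∈ M) :
    dmuM μ M x y ≤ dmuM μ M x w + dmuM μ M w y := by
  have key := finsum_mem_union (f := lamMax μ M) (separators_disjoint (μ := μ) (M := M)
    (x := x) (w := w) (y := y)) (separators_finite hM) (separators_finite hM)
  change ∑ᶠ h ∈ separators μ M x y, lamMax μ M h ≤
    ∑ᶠ h ∈ separators μ M x w, lamMax μ M h + ∑ᶠ h ∈ separators μ M w y, lamMax μ M h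
  rw [← key]
  have hfin := (separators_finite (μ := μ) (x := x) (y := w) hM).union
    (separators_finite (μ := μ) (x := w) (y := y) hM)
  rw [finsum_mem_eq_finite_toFinset_sum _ (separators_finite hM),
    finsum_mem_eq_finite_toFinset_sum _ hfin]
  exact Finset.sum_le_sum_of_subset_of_nonneg
    (Set.Finite.toFinset_mono (separators_subset_union hw)) fun _ _ _ => lamMax_nonneg

theorem dmuM_add (hM : M.Finite) (hx : x ∈ M) (hy : y ∈ M) (hw : w ∈ M)
    (hi : μ x y w = w) : dmuM μ M x y = dmuM μ M x w + dmuM μ M w y := by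
  change ∑ᶠ h ∈ separators μ M x y, lamMax μ M h = _
  rw [separators_eq_union hx hy hw hi]
  exact finsum_mem_union separators_disjoint (separators_finite hM) (separators_finite hM)

theorem dist_le_dmuM (hμ : IsMedianFn μ) (hM : M.Finite) (hsub : IsSubalgebra μ M)
    (ha : a ∈ M) (hb : b ∈ M) : dist a b ≤ dmuM μ M a b := by
  induction hn : {z ∈ M | μ a b z = z}.ncard using Nat.strong_induction_on generalizing a b with
  | _ n ih =>
  by_cases hab : a = b
  · rw [hab, dist_self]
    exact dmuM_nonneg
  by_cases hi : ∀ z ∈ M, μ a b z = z → z = a ∨ z = b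
  · have hadj := adjacentIn_of_interval hμ hsub ha hb hab hi
    obtain ⟨-, -, h, ⟨hh, hah, hbh⟩, -⟩ := id hadj
    rw [dmuM_eq_sum hM]
    refine (dist_le_lamMax hM hadj hah hbh).trans
      (Finset.single_le_sum (f := lamMax μ M) (fun _ _ => lamMax_nonneg) ?_)
    rw [Set.Finite.mem_toFinset]
    exact ⟨hh, hah, hb, hbh⟩
  · push Not at hi
    obtain ⟨c, hc, hci, hca, hcb⟩ := hi
    have hlt : ∀ p q, (∀ z, μ p q z = z → μ a b z = z) →
        (μ p q a ≠ a ∨ μ p q b ≠ b) → {z ∈ M | μ p q z = z}.ncard < n := by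
      intro p q hsubset hne
      rw [← hn]
      refine Set.ncard_lt_ncard ⟨fun z hz => ⟨hz.1, hsubset z hz.2⟩, fun hsup => ?_⟩
        (hM.subset (Set.sep_subset _ _))
      rcases hne with hne | hne
      · exact hne (hsup ⟨ha, hμ.outer_self a b⟩).2
      · exact hne (hsup ⟨hb, hμ.right_self a b⟩).2
    have h1 : dist a c ≤ dmuM μ M a c := by
      refine ih _ (hlt a c (fun z hz => ?_) (Or.inr fun h => ?_)) ha hc rfl
      · rw [← hz, ← hμ.rotate z]
        exact hμ.interval_median z (hμ.outer_self a b) hci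
      · exact hcb (hci.symm.trans ((hμ.swap_right a b c).trans h))
    have h2 : dist c b ≤ dmuM μ M c b := by
      refine ih _ (hlt c b (fun z hz => ?_) (Or.inl fun h => ?_)) hc hb rfl
      · rw [← hz, ← hμ.rotate z]
        exact hμ.interval_median z hci (hμ.right_self a b)
      · exact hca (hci.symm.trans ((hμ.rotate c a b).symm.trans ((hμ.swap_right c a b).trans h)))
    calc dist a b ≤ dist a c + dist c b := dist_triangle _ _ _
      _ ≤ dmuM μ M a c + dmuM μ M c b := add_le_add h1 h2
      _ = dmuM μ M a b := (dmuM_add hM ha hb hc hci).symm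

/-- The distance approximations increase with the finite subalgebra. -/
theorem dmuM_mono (hμ : IsMedianFn μ) (hN : N.Finite) (hsub : IsSubalgebra μ N)
    (hMN : M ⊆ N) : dmuM μ M x y ≤ dmuM μ N x y := by
  classical
  have hM : M.Finite := hN.subset hMN
  rcases (separators μ M x y).eq_empty_or_nonempty with hempty | ⟨h₀, hh₀⟩
  · change ∑ᶠ h ∈ separators μ M x y, lamMax μ M h ≤ _
    rw [hempty, finsum_mem_empty]
    exact dmuM_nonneg
  have hx : x ∈ M := hh₀.1.1 hh₀.2.1
  have hy : y ∈ M := hh₀.2.2.1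
  have hmaps : ∀ k ∈ (separators_finite (μ := μ) (x := x) (y := y) hN).toFinset,
      k ∩ M ∈ (separators_finite (μ := μ) (x := x) (y := y) hM).toFinset := by
    intro k hk
    rw [Set.Finite.mem_toFinset] at hk ⊢
    exact inter_mem_separators hMN hx hy hk
  rw [dmuM_eq_sum hM, dmuM_eq_sum hN, ← Finset.sum_fiberwise_of_maps_to hmaps]
  refine Finset.sum_le_sum fun h hh => ?_
  rw [Set.Finite.mem_toFinset] at hh
  refine Real.sSup_le ?_ (Finset.sum_nonneg fun k _ => lamMax_nonneg (h := k))
  rintro r ⟨a, b, ⟨ha, hb, huniq⟩, hah, hbh, rfl⟩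
  refine (dist_le_dmuM hμ hN hsub (hMN ha) (hMN hb)).trans ?_
  rw [dmuM_eq_sum hN]
  refine Finset.sum_le_sum_of_subset_of_nonneg (fun k hk => ?_) fun _ _ _ => lamMax_nonneg
  rw [Set.Finite.mem_toFinset] at hk
  have hkM := inter_mem_separators hMN ha hb hk
  have hkh : k ∩ M = h := huniq.unique ⟨hkM.1, hkM.2.1, hkM.2.2.2⟩ ⟨hh.1, hah, hbh.2⟩
  rw [Finset.mem_filter, Set.Finite.mem_toFinset]
  refine ⟨⟨hk.1, ?_, hMN hy, fun hyk => ?_⟩, hkh⟩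
  · exact (hkh.symm ▸ hh.2.1 : x ∈ k ∩ M).1
  · exact hh.2.2.2 (hkh ▸ ⟨hyk, hy⟩)

theorem dmuM_le_dmu (hrect : ∀ x y : X,
      BddAbove {r : ℝ | ∃ M : Set X, M.Finite ∧ IsSubalgebra μ M ∧ r = dmuM μ M x y})
    (hM : M.Finite) (hsub : IsSubalgebra μ M) : dmuM μ M x y ≤ dmu μ x y :=
  le_csSup (hrect x y) ⟨M, hM, hsub, rfl⟩

theorem dmu_le {c : ℝ} (hc : ∀ M : Set X, M.Finite → IsSubalgebra μ M → dmuM μ M x y ≤ c) :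
    dmu μ x y ≤ c := by
  refine csSup_le ⟨_, ∅, Set.finite_empty, fun a ha => ha.elim, rfl⟩ ?_
  rintro r ⟨M, hM, hsub, rfl⟩
  exact hc M hM hsub

theorem dmu_comm : dmu μ x y = dmu μ y x := by
  simp only [dmu, dmuM_comm (x := x) (y := y)]

theorem dmu_self : dmu μ x x = 0 :=
  (dmu_le fun _ _ _ => dmuM_self.le).antisymm
    (Real.sSup_nonneg fun _ ⟨_, _, _, h⟩ => h ▸ dmuM_nonneg)

theorem dist_le_dmu (hμ : IsMedianFn μ) (hrect : ∀ x y : X,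
      BddAbove {r : ℝ | ∃ M : Set X, M.Finite ∧ IsSubalgebra μ M ∧ r = dmuM μ M x y}) :
    dist x y ≤ dmu μ x y := by
  obtain ⟨N, hN, hsub, hxy⟩ := hμ.exists_finite_subalgebra (Set.toFinite {x, y})
  exact (dist_le_dmuM hμ hN hsub (hxy (by simp)) (hxy (by simp))).trans
    (dmuM_le_dmu hrect hN hsub)

theorem dmu_triangle (hμ : IsMedianFn μ) (hrect : ∀ x y : X,
      BddAbove {r : ℝ | ∃ M : Set X, M.Finite ∧ IsSubalgebra μ M ∧ r = dmuM μ M x y}) :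
    dmu μ x y ≤ dmu μ x w + dmu μ w y := by
  refine dmu_le fun M hM _ => ?_
  obtain ⟨N, hN, hNsub, hMN⟩ := hμ.exists_finite_subalgebra (hM.insert w)
  calc dmuM μ M x y ≤ dmuM μ N x y :=
        dmuM_mono hμ hN hNsub ((Set.subset_insert w M).trans hMN)
    _ ≤ dmuM μ N x w + dmuM μ N w y := dmuM_triangle hN (hMN (Set.mem_insert w M))
    _ ≤ dmu μ x w + dmu μ w y :=
        add_le_add (dmuM_le_dmu hrect hN hNsub) (dmuM_le_dmu hrect hN hNsub)

theorem dmu_add (hμ : IsMedianFn μ) (hrect : ∀ x y : X,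
      BddAbove {r : ℝ | ∃ M : Set X, M.Finite ∧ IsSubalgebra μ M ∧ r = dmuM μ M x y})
    (hi : μ x y w = w) : dmu μ x w + dmu μ w y = dmu μ x y := by
  refine le_antisymm ?_ (dmu_triangle hμ hrect)
  rw [← le_sub_iff_add_le]
  refine dmu_le fun M₁ hM₁ _ => ?_
  rw [le_sub_comm]
  refine dmu_le fun M₂ hM₂ _ => ?_
  rw [le_sub_iff_add_le']
  obtain ⟨N, hN, hNsub, hsub⟩ :=
    hμ.exists_finite_subalgebra ((hM₁.union hM₂).union (Set.toFinite {x, y, w}))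
  have h1 : M₁ ⊆ N := fun z hz => hsub (Or.inl (Or.inl hz))
  have h2 : M₂ ⊆ N := fun z hz => hsub (Or.inl (Or.inr hz))
  calc dmuM μ M₁ x w + dmuM μ M₂ w y ≤ dmuM μ N x w + dmuM μ N w y :=
        add_le_add (dmuM_mono hμ hN hNsub h1) (dmuM_mono hμ hN hNsub h2)
    _ = dmuM μ N x y := (dmuM_add hN (hsub (Or.inr (by simp))) (hsub (Or.inr (by simp)))
        (hsub (Or.inr (by simp))) hi).symm
    _ ≤ dmu μ x y := dmuM_le_dmu hrect hN hNsub

/-- Metric intervals of `dmu` are median intervals. -/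
theorem dmu_add_eq_iff (hμ : IsMedianFn μ) (hrect : ∀ x y : X,
      BddAbove {r : ℝ | ∃ M : Set X, M.Finite ∧ IsSubalgebra μ M ∧ r = dmuM μ M x y}) :
    dmu μ x w + dmu μ w y = dmu μ x y ↔ μ x y w = w := by
  refine ⟨fun h => ?_, dmu_add hμ hrect⟩
  have e1 := dmu_add (x := x) (y := y) hμ hrect (hμ.proj_proj x y w)
  have e2 := dmu_add (x := x) (y := w) (w := μ x y w) hμ hrect (by
    rw [hμ.swap_right x y w, hμ.proj_proj])
  have e3 := dmu_add (x := w) (y := y) (w := μ x y w) hμ hrect (by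
    rw [hμ.swap_left w y, hμ.rotate x y w, hμ.proj_proj])
  have hd := dist_le_dmu (x := w) (y := μ x y w) hμ hrect
  have hc := dmu_comm (μ := μ) (x := w) (y := μ x y w)
  exact (dist_le_zero.1 (by linarith)).symm

end Distance

section Invariance

variable {X Y : Type*} {μ : X → X → X → X} {ν : Y → Y → Y → Y} {M h : Set X} {x y a b : X}

theorem IsSubalgebra.image (g : X → Y) (hg : ∀ a b c, g (μ a b c) = ν (g a) (g b) (g c))
    (hM : IsSubalgebra μ M) : IsSubalgebra ν (g '' M) := by
  rintro _ ⟨a, ha, rfl⟩ _ ⟨b, hb, rfl⟩ _ ⟨c, hc, rfl⟩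
  exact ⟨μ a b c, hM a ha b hb c hc, hg a b c⟩

theorem convexIn_image_iff {g : X → Y} (hinj : g.Injective)
    (hg : ∀ a b c, g (μ a b c) = ν (g a) (g b) (g c)) :
    ConvexIn ν (g '' M) (g '' h) ↔ ConvexIn μ M h := by
  simp only [ConvexIn, Set.forall_mem_image, ← hg, hinj.eq_iff, hinj.mem_set_image]

theorem isHalfspaceIn_image_iff {g : X → Y} (hinj : g.Injective)
    (hg : ∀ a b c, g (μ a b c) = ν (g a) (g b) (g c)) :
    IsHalfspaceIn ν (g '' M) (g '' h) ↔ IsHalfspaceIn μ M h := by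
  simp only [IsHalfspaceIn, ← Set.image_sdiff hinj, convexIn_image_iff hinj hg,
    Set.image_subset_image_iff hinj, Set.image_nonempty]

theorem separators_image {g : X → Y} (hinj : g.Injective)
    (hg : ∀ a b c, g (μ a b c) = ν (g a) (g b) (g c)) :
    separators ν (g '' M) (g x) (g y) = (g '' ·) '' separators μ M x y := by
  ext k
  constructor
  · rintro ⟨hk, hx, hy⟩
    obtain ⟨h, -, rfl⟩ := Set.subset_image_iff.1 hk.1
    rw [← Set.image_sdiff hinj, hinj.mem_set_image] at hy
    exact ⟨h, ⟨(isHalfspaceIn_image_iff hinj hg).1 hk, hinj.mem_set_image.1 hx, hy⟩, rfl⟩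
  · rintro ⟨h, ⟨hh, hx, hy⟩, rfl⟩
    refine ⟨(isHalfspaceIn_image_iff hinj hg).2 hh, Set.mem_image_of_mem g hx, ?_⟩
    rw [← Set.image_sdiff hinj]
    exact Set.mem_image_of_mem g hy

theorem adjacentIn_iff_separators :
    AdjacentIn μ M a b ↔ a ∈ M ∧ b ∈ M ∧ ∃ h, separators μ M a b = {h} := by
  refine and_congr_right fun _ => and_congr_right fun hb => ?_
  simp only [Set.eq_singleton_iff_unique_mem, separators, Set.mem_ofPred_eq, Set.mem_sdiff, hb,
    true_and]
  rfl

theorem adjacentIn_image_iff {g : X → Y} (hinj : g.Injective)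
    (hg : ∀ a b c, g (μ a b c) = ν (g a) (g b) (g c)) :
    AdjacentIn ν (g '' M) (g a) (g b) ↔ AdjacentIn μ M a b := by
  simp only [adjacentIn_iff_separators, hinj.mem_set_image, separators_image hinj hg]
  refine and_congr_right fun _ => and_congr_right fun _ => ⟨?_, ?_⟩
  · rintro ⟨k, hk⟩
    obtain ⟨h, hh⟩ : (separators μ M a b).Nonempty :=
      Set.image_nonempty.1 (hk ▸ Set.singleton_nonempty k)
    have hs : ((g '' ·) '' separators μ M a b).Subsingleton := hk ▸ Set.subsingleton_singleton
    exact ⟨h, (Set.subsingleton_of_image hinj.image_injective _ hs).eq_singleton_of_mem hh⟩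
  · rintro ⟨h, hh⟩
    exact ⟨g '' h, by rw [hh, Set.image_singleton]⟩

end Invariance

section Isometry

variable {X Y : Type*} [MetricSpace X] [MetricSpace Y] {μ : X → X → X → X} {ν : Y → Y → Y → Y}
  {M h : Set X} {x y : X}

theorem lamMax_image {g : X → Y} (hiso : Isometry g)
    (hg : ∀ a b c, g (μ a b c) = ν (g a) (g b) (g c)) :
    lamMax ν (g '' M) (g '' h) = lamMax μ M h := by
  have hinj := hiso.injective
  unfold lamMax
  congr 1
  ext r
  constructor
  · rintro ⟨_, _, hab, ⟨a, ha, rfl⟩, ⟨⟨b, hb, rfl⟩, hbh⟩, rfl⟩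
    exact ⟨a, b, (adjacentIn_image_iff hinj hg).1 hab, ha,
      ⟨hb, fun h' => hbh (Set.mem_image_of_mem g h')⟩, hiso.dist_eq a b⟩
  · rintro ⟨a, b, hab, ha, hb, rfl⟩
    exact ⟨g a, g b, (adjacentIn_image_iff hinj hg).2 hab, Set.mem_image_of_mem g ha,
      ⟨Set.mem_image_of_mem g hb.1, fun h' => hb.2 (hinj.mem_set_image.1 h')⟩,
      (hiso.dist_eq a b).symm⟩

theorem dmuM_image {g : X → Y} (hiso : Isometry g)
    (hg : ∀ a b c, g (μ a b c) = ν (g a) (g b) (g c)) :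
    dmuM ν (g '' M) (g x) (g y) = dmuM μ M x y := by
  change ∑ᶠ h ∈ separators ν (g '' M) (g x) (g y), lamMax ν (g '' M) h = _
  rw [separators_image hiso.injective hg,
    finsum_mem_image hiso.injective.image_injective.injOn]
  exact finsum_mem_congr rfl fun _ _ => lamMax_image hiso hg

theorem dmu_map {g : X → Y} (hiso : Isometry g) (hsurj : g.Surjective)
    (hg : ∀ a b c, g (μ a b c) = ν (g a) (g b) (g c)) :
    dmu ν (g x) (g y) = dmu μ x y := by
  unfold dmu
  congr 1
  ext r
  constructor
  · rintro ⟨K, hK, hsub, rfl⟩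
    have hKg : g '' (g ⁻¹' K) = K := Set.image_preimage_eq K hsurj
    refine ⟨g ⁻¹' K, hK.preimage hiso.injective.injOn, fun a ha b hb c hc => ?_, ?_⟩
    · rw [Set.mem_preimage, hg]
      exact hsub _ ha _ hb _ hc
    · rw [← dmuM_image hiso hg, hKg]
  · rintro ⟨M, hM, hsub, rfl⟩
    exact ⟨g '' M, hM.image g, hsub.image g hg, (dmuM_image hiso hg).symm⟩

end Isometry

/-- For a rectifiable metric median algebra `(X, d, μ)` (the suprema defining
`d_μ` are finite), `d_μ` is a metric on `X`; `(X, d_μ)` is a median metric space whose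
intrinsic median operation equals `μ`; `d_μ` is invariant under every isometric
automorphism of `(X, d, μ)`; and if `(X, d, μ)` is uniformly rectifiable with constant `L`
then `d(x,y) ≤ d_μ(x,y) ≤ L·d(x,y)` for all `x, y`. -/
theorem stmt_5 {X : Type*} [MetricSpace X] (μ : X → X → X → X)
    (hmed : IsMedianFn μ)
    (hcont : Continuous fun p : X × X × X => μ p.1 p.2.1 p.2.2)
    (hrect : ∀ x y : X,
      BddAbove {r : ℝ | ∃ M : Set X, M.Finite ∧ IsSubalgebra μ M ∧ r = dmuM μ M x y}) :
    (∀ x y : X, dmu μ x y = dmu μ y x) ∧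
      (∀ x y : X, dmu μ x y = 0 ↔ x = y) ∧
      (∀ x y z : X, dmu μ x z ≤ dmu μ x y + dmu μ y z) ∧
      (∀ x y z : X,
        {w : X | dmu μ x w + dmu μ w y = dmu μ x y} ∩
            {w : X | dmu μ y w + dmu μ w z = dmu μ y z} ∩
            {w : X | dmu μ z w + dmu μ w x = dmu μ z x} = {μ x y z}) ∧
      (∀ g : X → X, Isometry g → Function.Bijective g →
        (∀ x₁ x₂ x₃ : X, g (μ x₁ x₂ x₃) = μ (g x₁) (g x₂) (g x₃)) →
        ∀ x y : X, dmu μ (g x) (g y) = dmu μ x y) ∧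
      ∀ L : ℝ,
        (∀ M : Set X, M.Finite → IsSubalgebra μ M → ∀ x y : X, dmuM μ M x y ≤ L * dist x y) →
        ∀ x y : X, dist x y ≤ dmu μ x y ∧ dmu μ x y ≤ L * dist x y := by
  refine ⟨fun x y => dmu_comm, fun x y => ⟨fun h => ?_, ?_⟩, fun x y z =>
    dmu_triangle hmed hrect, fun x y z => ?_, fun g hiso hbij hg x y =>
    dmu_map hiso hbij.surjective hg, fun L hL x y => ⟨dist_le_dmu hmed hrect,
      dmu_le fun M hM hsub => hL M hM hsub x y⟩⟩
  · exact dist_le_zero.1 (h ▸ dist_le_dmu hmed hrect)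
  · rintro rfl
    exact dmu_self
  · ext w
    simp only [Set.mem_inter_iff, Set.mem_ofPred_eq, dmu_add_eq_iff hmed hrect,
      Set.mem_singleton_iff]
    refine ⟨fun h => hmed.eq_median_of_mem_intervals h.1.1 h.1.2 h.2, ?_⟩
    rintro rfl
    refine ⟨⟨hmed.proj_proj x y z, ?_⟩, ?_⟩
    · rw [hmed.rotate x y z, hmed.proj_proj]
    · rw [← hmed.rotate z x y, hmed.proj_proj]
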